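/- Let Δ be a pure simplicial complex with dim Δ = d − 1 and let ℓ ≥ 1. If depth(S/I_Δ^(ℓ)) = 1, then depth(S/I_Δ^(ℓ+d)) = 1. -/

import Mathlib

/-!
Common definitions for formalizing "The Serre depth of Stanley–Reisner rings and
the depth of their symbolic powers" (Muta–Terai).
-/

open CategoryTheory MvPolynomial

noncomputable section

namespace SerrePaper

/-! ### Simplicial complexes (given by their sets of faces) -/

variable {V : Type}

/-- A (nonempty, downward closed) abstract simplicial complex, given by its set of faces. -/
def IsComplex (K : Set (Finset V)) : Prop :=
  K.Nonempty ∧ ∀ F ∈ K, ∀ G ⊆ F, G ∈ K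

/-- `F` is a facet (maximal face) of `K`. -/
def IsFacet (K : Set (Finset V)) (F : Finset V) : Prop :=
  F ∈ K ∧ ∀ G ∈ K, F ⊆ G → G = F

/-- `K` is pure: all facets have the same cardinality. -/
def Pure (K : Set (Finset V)) : Prop :=
  ∀ F G : Finset V, IsFacet K F → IsFacet K G → F.card = G.card

/-- `dim K = d - 1`, i.e. the maximal cardinality of a face of `K` is `d`. -/
def HasDimCard (K : Set (Finset V)) (d : ℕ) : Prop :=
  (∃ F ∈ K, F.card = d) ∧ ∀ F ∈ K, F.card ≤ d

/-- the link of the face `F` in `K`. -/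
def link [DecidableEq V] (K : Set (Finset V)) (F : Finset V) : Set (Finset V) :=
  { G | G ∪ F ∈ K ∧ G ∩ F = ∅ }

/-- `skeleton K t` is the `(t-1)`-skeleton `K^{t-1}` of `K`:
all faces with at most `t` vertices. -/
def skeleton (K : Set (Finset V)) (t : ℕ) : Set (Finset V) :=
  { F ∈ K | F.card ≤ t }

/-- The Alexander dual complex `K^∨ = { F | complement of F is not a face of K }`. -/
def dualComplex [Fintype V] [DecidableEq V] (K : Set (Finset V)) : Set (Finset V) :=
  { F | Fᶜ ∉ K }

/-- The copy of `K` on its own vertex set (as a complex on the corresponding subtype). -/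
def restrictVerts (K : Set (Finset V)) : Set (Finset {v : V // {v} ∈ K}) :=
  { F | F.map (Function.Embedding.subtype _) ∈ K }

/-- The induced subcomplex `K_W` on a subset `W` of the vertices. -/
def inducedSub (K : Set (Finset V)) (W : Finset V) : Set (Finset V) :=
  { F ∈ K | F ⊆ W }

/-- `K` is a matroid complex: every induced subcomplex is pure. -/
def IsMatroidComplex (K : Set (Finset V)) : Prop :=
  ∀ W : Finset V, Pure (inducedSub K W)

/-! ### Reduced simplicial homology with coefficients in a field `k` -/

/-- The group of simplicial `(c-1)`-chains: formal `k`-linear combinations of the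
faces of `K` with exactly `c` vertices. -/
abbrev chainGroup (k : Type) [Field k] (K : Set (Finset V)) (c : ℕ) : Type :=
  {F : Finset V // F ∈ K ∧ F.card = c} →₀ k

open Classical in
/-- the boundary of a single face, `∂F = ∑_{x ∈ F} (-1)^{pos of x in F} (F \ {x})`. -/
def boundaryAt (k : Type) [Field k] [LinearOrder V] (K : Set (Finset V)) (c : ℕ)
    (F : {F : Finset V // F ∈ K ∧ F.card = c + 1}) : chainGroup k K c :=
  ∑ x ∈ F.1.attach,
    if h : F.1.erase x.1 ∈ K then
      Finsupp.single
        ⟨F.1.erase x.1, h, by simp [Finset.card_erase_of_mem x.2, F.2.2]⟩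
        ((-1 : k) ^ (F.1.filter (fun y => y < x.1)).card)
    else 0

/-- The simplicial boundary map (for a downward closed `K` this is the usual
boundary map of the reduced (augmented) chain complex of `K`, where faces with
`c` vertices sit in homological degree `c - 1`). -/
def boundary (k : Type) [Field k] [LinearOrder V] (K : Set (Finset V)) (c : ℕ) :
    chainGroup k K (c + 1) →ₗ[k] chainGroup k K c :=
  Finsupp.lsum k fun F => LinearMap.toSpanSingleton k _ (boundaryAt k K c F)

/-- `H̃ᵢ(K; k) = 0`: every reduced `i`-cycle is a boundary.  (For `i ≤ -2` this holds
trivially; for `i = -1` the relevant cycle group is the whole of the `(-1)`-chains.) -/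
def reducedHomologyVanishes (k : Type) [Field k] [LinearOrder V]
    (K : Set (Finset V)) (i : ℤ) : Prop :=
  if i < -1 then True
  else if i = -1 then
    ∀ z : chainGroup k K 0, ∃ b : chainGroup k K 1, boundary k K 0 b = z
  else
    ∀ z : chainGroup k K (i.toNat + 1), boundary k K i.toNat z = 0 →
      ∃ b : chainGroup k K (i.toNat + 2), boundary k K (i.toNat + 1) b = z

/-- Nonvanishing `β_{i,j}(k[K]) ≠ 0` of the graded Betti numbers of the
Stanley–Reisner ring of `K`, expressed via Hochster's formula:
`β_{i,j}(k[K]) = ∑_{W ⊆ V, |W| = j} dim_k H̃_{j-i-1}(K_W; k)`. -/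
def bettiNonzero (k : Type) [Field k] [LinearOrder V] (K : Set (Finset V)) (i j : ℕ) : Prop :=
  ∃ W : Finset V, W.card = j ∧
    ¬ reducedHomologyVanishes k (inducedSub K W) ((j : ℤ) - i - 1)

/-- `reg_{≤ r} I_K = max{ j : β_{i,i+j}(I_K) ≠ 0 for some i ≤ r }`, where
`β_{i,d}(I_K) = β_{i+1,d}(k[K])`. -/
def regLEIdeal (k : Type) [Field k] [LinearOrder V] (K : Set (Finset V)) (r : ℕ) : ℕ :=
  sSup { j : ℕ | ∃ i ≤ r, bettiNonzero k K (i + 1) (i + j) }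

/-- `indeg I_K`: the least degree of a minimal generator of the Stanley–Reisner
ideal of `K`, i.e. `min{ j : β_{0,j}(I_K) = β_{1,j}(k[K]) ≠ 0 }`. -/
def indegIdeal (k : Type) [Field k] [LinearOrder V] (K : Set (Finset V)) : ℕ :=
  sInf { j : ℕ | bettiNonzero k K 1 j }

/-! ### Stanley–Reisner rings, Serre depth, depth, symbolic powers -/

variable (k : Type) [Field k]

/-- The Stanley–Reisner ideal of `K` (generated by the monomials of the non-faces,
equivalently by those of the minimal non-faces). -/
def srIdeal (K : Set (Finset V)) : Ideal (MvPolynomial V k) :=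
  Ideal.span { m | ∃ F : Finset V, F ∉ K ∧ m = ∏ i ∈ F, X i }

/-- The homogeneous maximal ideal `(x_v : v ∈ V)` of the polynomial ring. -/
def maxIdeal (V : Type) : Ideal (MvPolynomial V k) :=
  Ideal.span (Set.range X)

/-- The quotient ring `S/I` as an object of `ModuleCat S`. -/
def quotMod {V : Type} (I : Ideal (MvPolynomial V k)) : ModuleCat (MvPolynomial V k) :=
  ModuleCat.of _ (MvPolynomial V k ⧸ I)

/-- The Stanley–Reisner ring `k[K] = S/I_K` as a module over `S`. -/
def srRing (K : Set (Finset V)) : ModuleCat (MvPolynomial V k) :=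
  quotMod k (srIdeal k K)

/-- The Krull dimension of a module, `dim M = dim (R / ann M)` (so `dim 0 = ⊥ = -∞`). -/
def modDim {R : Type} [CommRing R] (M : ModuleCat R) : WithBot ℕ∞ :=
  ringKrullDim (R ⧸ Module.annihilator R M)

/-- `Ext_R^i(M, N)` as an `R`-module. -/
def extM {R : Type} [CommRing R] (M N : ModuleCat R) (i : ℕ) : ModuleCat R :=
  ((Ext R (ModuleCat R) i).obj (Opposite.op M)).obj N

/-- `K_M^j = Ext_S^{n-j}(M, ω_S)`, the (Matlis dual of) local cohomology; since the
canonical module `ω_S` of the polynomial ring `S` is `S` itself up to a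
grading shift, we use `Ext_S^{n-j}(M, S)`. -/
def serreK {V : Type} (M : ModuleCat (MvPolynomial V k)) (j : ℕ) :
    ModuleCat (MvPolynomial V k) :=
  extM M (ModuleCat.of _ (MvPolynomial V k)) (Nat.card V - j)

/-- The Serre depth `S_r-depth(M) = min{ j : dim K_M^j ≥ j - r + 1 }`.
(Note that, since `dim K_M^j` is either `⊥` or `≥ 0`, the inequality
`dim K_M^j ≥ j - r + 1` of (possibly negative) integers is equivalent to
`(j + 1 - r : ℕ) ≤ dim K_M^j` with truncated subtraction.) -/
def serreDepth {V : Type} (r : ℕ) (M : ModuleCat (MvPolynomial V k)) : ℕ :=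
  sInf { j : ℕ | ((j + 1 - r : ℕ) : WithBot ℕ∞) ≤ modDim (serreK k M j) }

/-- Serre's condition `(S_r)` for an unmixed module: `S_r-depth(M) = dim M`. -/
def serreCond {V : Type} (r : ℕ) (M : ModuleCat (MvPolynomial V k)) : Prop :=
  (serreDepth k r M : WithBot ℕ∞) = modDim M

/-- The depth of `M` with respect to the homogeneous maximal ideal,
via Rees' characterization `depth M = min{ i : Ext^i(S/m, M) ≠ 0 }`. -/
def mdepth {V : Type} (M : ModuleCat (MvPolynomial V k)) : ℕ :=
  sInf { i : ℕ | Nontrivial (extM (quotMod k (maxIdeal k V)) M i) }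

/-- `M` is Cohen–Macaulay: `depth M = dim M`. -/
def isCM {V : Type} (M : ModuleCat (MvPolynomial V k)) : Prop :=
  (mdepth k M : WithBot ℕ∞) = modDim M

/-- The `ℓ`-th symbolic power of a (radical, e.g. squarefree monomial) ideal:
`I^(ℓ) = ⋂_{P ∈ Min(I)} P^ℓ`. -/
def symbPow {R : Type} [CommRing R] (I : Ideal R) (ℓ : ℕ) : Ideal R :=
  sInf { J | ∃ P ∈ I.minimalPrimes, J = P ^ ℓ }

/-- The height of an ideal: the Krull dimension of the poset of primes contained in it. -/
def idealHeight {R : Type} [CommRing R] (p : Ideal R) : WithBot ℕ∞ :=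
  Order.krullDim { q : PrimeSpectrum R // q.asIdeal ≤ p }

/-- `R/I` is unmixed: all associated primes of `R/I` have the same height. -/
def IsUnmixedIdeal {R : Type} [CommRing R] (I : Ideal R) : Prop :=
  ∀ p q : Ideal R, p ∈ associatedPrimes R (R ⧸ I) → q ∈ associatedPrimes R (R ⧸ I) →
    idealHeight p = idealHeight q

/-- Nonvanishing of the first local cohomology `H_m^1(S/I) ≠ 0`. -/
def H1NE {V : Type} (I : Ideal (MvPolynomial V k)) : Prop :=
  Nontrivial ((localCohomology (maxIdeal k V) 1).obj (quotMod k I))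

/-- `I` is a squarefree monomial ideal. -/
def IsSqFreeMonomialIdeal {V : Type} (I : Ideal (MvPolynomial V k)) : Prop :=
  ∃ G : Set (Finset V), I = Ideal.span ((fun F => ∏ i ∈ F, X i) '' G)

end SerrePaper

end
namespace SerrePaper

/-- Let `P₂ → P₁ → P₀ → R/I → 0` be exact with `P₀` projective.  The complex
`Hom(P₀, M) → Hom(P₁, M) → Hom(P₂, M)` is exact if and only if every linear map `I → M` is
multiplication by an element of `M`. -/
lemma hom_exact_iff_forall_eq_smul {R P₀ P₁ P₂ M : Type*} [CommRing R] (I : Ideal R)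
    [AddCommGroup P₀] [AddCommGroup P₁] [AddCommGroup P₂] [AddCommGroup M]
    [Module R P₀] [Module R P₁] [Module R P₂] [Module R M] [Module.Projective R P₀]
    (d₂ : P₂ →ₗ[R] P₁) (d₁ : P₁ →ₗ[R] P₀) (π : P₀ →ₗ[R] R ⧸ I)
    (hπ : Function.Surjective π) (h₁ : Function.Exact d₂ d₁) (h₀ : Function.Exact d₁ π) :
    (∀ f : P₁ →ₗ[R] M, f ∘ₗ d₂ = 0 → ∃ g : P₀ →ₗ[R] M, g ∘ₗ d₁ = f) ↔
      ∀ φ : I →ₗ[R] M, ∃ y : M, ∀ x : I, φ x = (x : R) • y := by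
  obtain ⟨v, hv⟩ := Module.projective_lifting_property (Submodule.mkQ I) π
    (Submodule.mkQ_surjective I)
  obtain ⟨u, hu⟩ := Module.projective_lifting_property π (Submodule.mkQ I) hπ
  have hv' : ∀ p, Submodule.mkQ I (v p) = π p := fun p => LinearMap.congr_fun hv p
  have hu' : ∀ r, π (u r) = Submodule.mkQ I r := fun r => LinearMap.congr_fun hu r
  constructor
  · intro H φ
    have hvd : ∀ p, v (d₁ p) ∈ I := by
      intro p
      rw [← Submodule.Quotient.mk_eq_zero I]
      exact (hv' _).trans (h₀.apply_apply_eq_zero p)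
    obtain ⟨g, hg⟩ := H (φ ∘ₗ (v ∘ₗ d₁).codRestrict I hvd) (by
      ext p
      simp only [LinearMap.comp_apply, LinearMap.zero_apply]
      convert φ.map_zero
      ext
      simp [h₁.apply_apply_eq_zero p])
    have hc : 1 - v (u 1) ∈ I := by
      rw [← Submodule.Quotient.mk_eq_zero I, Submodule.Quotient.mk_sub, sub_eq_zero]
      exact ((hv' _).trans (hu' 1)).symm
    refine ⟨g (u 1) + φ ⟨_, hc⟩, fun x => ?_⟩
    have hx : π (u x) = 0 := by
      rw [hu']
      exact (Submodule.Quotient.mk_eq_zero I).2 x.2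
    obtain ⟨p, hp⟩ := (h₀ _).1 hx
    have hgu : g (u x) = φ ⟨v (u x), by rw [← hp]; exact hvd p⟩ := by
      have := LinearMap.congr_fun hg p
      simp only [LinearMap.comp_apply] at this
      rw [hp] at this
      rw [this]
      congr 1
      ext
      simp [hp]
    have hux : u (x : R) = (x : R) • u 1 := by rw [← map_smul]; simp
    rw [smul_add, ← map_smul g, ← hux, hgu, ← map_smul, ← map_add]
    congr 1
    ext
    simp [hux]
    ring
  · intro H f hf
    have hfk : LinearMap.ker d₁ ≤ LinearMap.ker f := by
      intro p hp
      obtain ⟨q, rfl⟩ := (h₁ p).1 hp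
      exact LinearMap.congr_fun hf q
    let ψ : LinearMap.range d₁ →ₗ[R] M :=
      (LinearMap.ker d₁).liftQ f hfk ∘ₗ d₁.quotKerEquivRange.symm.toLinearMap
    have hψ : ∀ p, ψ ⟨d₁ p, p, rfl⟩ = f p := by
      intro p
      have : d₁.quotKerEquivRange.symm ⟨d₁ p, p, rfl⟩ = Submodule.Quotient.mk p := by
        rw [LinearEquiv.symm_apply_eq]
        rfl
      simp [ψ, this]
    have hui : ∀ x : I, u x ∈ LinearMap.range d₁ := by
      intro x
      refine (h₀ _).1 ?_
      rw [hu']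
      exact (Submodule.Quotient.mk_eq_zero I).2 x.2
    have huv : ∀ p, (LinearMap.id - u ∘ₗ v : P₀ →ₗ[R] P₀) p ∈ LinearMap.range d₁ := by
      intro p
      refine (h₀ _).1 ?_
      rw [LinearMap.sub_apply, map_sub, LinearMap.comp_apply, hu', hv', LinearMap.id_apply,
        sub_self]
    obtain ⟨y, hy⟩ := H (ψ ∘ₗ (u ∘ₗ I.subtype).codRestrict _ hui)
    refine ⟨LinearMap.toSpanSingleton R M y ∘ₗ v +
      ψ ∘ₗ (LinearMap.id - u ∘ₗ v).codRestrict _ huv, ?_⟩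
    ext p
    have hvd : v (d₁ p) ∈ I := by
      rw [← Submodule.Quotient.mk_eq_zero I]
      exact (hv' _).trans (h₀.apply_apply_eq_zero p)
    have := hy ⟨_, hvd⟩
    simp only [LinearMap.comp_apply, LinearMap.add_apply, LinearMap.toSpanSingleton_apply] at this ⊢
    rw [← this, ← map_add, ← hψ]
    congr 1
    ext
    change u (v (d₁ p)) + (d₁ p - u (v (d₁ p))) = d₁ p
    abel

/-- The augmentation of a projective resolution is surjective and its kernel is the range of the
first differential. -/
lemma projectiveResolution_exact {R : Type} [CommRing R] {N : ModuleCat R}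
    (P : ProjectiveResolution N) :
    ∃ π : P.complex.X 0 →ₗ[R] N, Function.Surjective π ∧
      Function.Exact (P.complex.d 1 0).hom π :=
  ⟨(P.π.f 0).hom, (ModuleCat.epi_iff_surjective _).1 inferInstance,
    (ShortComplex.ShortExact.moduleCat_exact_iff_function_exact _).1
      (ShortComplex.exact_of_g_is_cokernel (.mk _ _ P.complex_d_comp_π_f_zero)
        P.isColimitCokernelCofork)⟩

/-- If `Ext⁰(R/I, M) ≠ 0` then some nonzero element of `M` is killed by `I`. -/
lemma exists_ne_zero_of_nontrivial_extM_zero {R : Type} [CommRing R] (I : Ideal R)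
    (M : ModuleCat R) (h : Nontrivial (extM (ModuleCat.of R (R ⧸ I)) M 0)) :
    ∃ y : M, y ≠ 0 ∧ ∀ x ∈ I, x • y = 0 := by
  contrapose! h
  let P := projectiveResolution (ModuleCat.of R (R ⧸ I))
  have e := P.isoExt (R := R) 0 M
  rw [extM, e.toLinearEquiv.toEquiv.subsingleton_congr, ← ModuleCat.isZero_iff_subsingleton,
    ← HomologicalComplex.exactAt_iff_isZero_homology,
    HomologicalComplex.exactAt_iff' _ 0 0 1 (by simp) (by simp),
    ShortComplex.moduleCat_exact_iff]
  obtain ⟨π, hπ, h₀⟩ := projectiveResolution_exact P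
  intro (f : P.complex.X 0 ⟶ M) (hf : P.complex.d 1 0 ≫ f = 0)
  refine ⟨0, (map_zero _).trans ?_⟩
  symm
  refine ModuleCat.hom_ext (LinearMap.ext fun p => ?_)
  obtain ⟨z, hz⟩ := hπ (Submodule.mkQ I 1)
  have hy : f.hom z = 0 := by
    by_contra hne
    obtain ⟨x, hx, hxz⟩ := h _ hne
    rw [← map_smul] at hxz
    obtain ⟨q, hq⟩ := (h₀ (x • z)).1 (by
      rw [map_smul, hz, ← map_smul]
      exact (Submodule.Quotient.mk_eq_zero I).2 (by simpa using hx))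
    rw [← hq] at hxz
    exact hxz (LinearMap.congr_fun (congrArg ModuleCat.Hom.hom hf) q)
  obtain ⟨r, hr⟩ := Submodule.mkQ_surjective I (π p)
  obtain ⟨q, hq⟩ := (h₀ (p - r • z)).1 (by
    rw [map_sub, map_smul, hz, ← map_smul, ← hr, smul_eq_mul, mul_one, sub_self])
  have h2 : f.hom (p - r • z) = 0 := by
    rw [← hq]
    exact LinearMap.congr_fun (congrArg ModuleCat.Hom.hom hf) q
  rw [map_sub, map_smul, hy, smul_zero, sub_zero] at h2
  exact h2

/-- `Ext¹(R/I, M) ≠ 0` if and only if some linear map `I → M` is not multiplication by an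
element of `M`. -/
lemma nontrivial_extM_one_iff {R : Type} [CommRing R] (I : Ideal R) (M : ModuleCat R) :
    Nontrivial (extM (ModuleCat.of R (R ⧸ I)) M 1) ↔
      ∃ φ : I →ₗ[R] M, ∀ y : M, ∃ x : I, φ x ≠ (x : R) • y := by
  let P := projectiveResolution (ModuleCat.of R (R ⧸ I))
  have e := P.isoExt (R := R) 1 M
  rw [← not_subsingleton_iff_nontrivial, not_iff_comm]
  push Not
  rw [extM, e.toLinearEquiv.toEquiv.subsingleton_congr, ← ModuleCat.isZero_iff_subsingleton,
    ← HomologicalComplex.exactAt_iff_isZero_homology,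
    HomologicalComplex.exactAt_iff' _ 0 1 2 (by simp) (by simp),
    ShortComplex.moduleCat_exact_iff]
  have hproj : Module.Projective R (P.complex.X 0) :=
    (IsProjective.iff_projective _).2 (P.projective 0)
  obtain ⟨π, hπ, h₀⟩ := projectiveResolution_exact P
  rw [← hom_exact_iff_forall_eq_smul I (P.complex.d 2 1).hom (P.complex.d 1 0).hom π]
  · constructor
    · intro H (f : P.complex.X 1 ⟶ M) (hf : P.complex.d 2 1 ≫ f = 0)
      obtain ⟨g, hg⟩ := H f.hom (congrArg ModuleCat.Hom.hom hf)
      exact ⟨(ModuleCat.ofHom g : P.complex.X 0 ⟶ M), ModuleCat.hom_ext hg⟩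
    · intro H f hf
      obtain ⟨g, hg⟩ := H (ModuleCat.ofHom f : P.complex.X 1 ⟶ M) (ModuleCat.hom_ext hf)
      exact ⟨(show P.complex.X 0 ⟶ M from g).hom,
        congrArg (fun t : P.complex.X 1 ⟶ M => t.hom) hg⟩
  · exact hπ
  · exact (ShortComplex.ShortExact.moduleCat_exact_iff_function_exact _).1 (P.exact_succ 0)
  · exact h₀

/-- If `M` embeds into a module `E` without nonzero elements killed by `I`, and some `e ∉ M`
satisfies `I e ⊆ M`, then `Ext¹(R/I, M) ≠ 0`. -/
lemma nontrivial_extM_one_of_injective {R : Type} [CommRing R] (I : Ideal R) (M : ModuleCat R)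
    {E : Type*} [AddCommGroup E] [Module R E] (f : M →ₗ[R] E) (hf : Function.Injective f)
    (hE : ∀ e : E, (∀ x ∈ I, x • e = 0) → e = 0) (e : E) (he : e ∉ LinearMap.range f)
    (hIe : ∀ x ∈ I, x • e ∈ LinearMap.range f) :
    Nontrivial (extM (ModuleCat.of R (R ⧸ I)) M 1) := by
  rw [nontrivial_extM_one_iff]
  refine ⟨(LinearEquiv.ofInjective f hf).symm.toLinearMap ∘ₗ
    (LinearMap.toSpanSingleton R E e ∘ₗ I.subtype).codRestrict _ fun x => hIe x x.2, fun y => ?_⟩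
  by_contra! h
  have hy : ∀ x ∈ I, x • (e - f y) = 0 := by
    intro x hx
    have h2 := congrArg f (h ⟨x, hx⟩)
    rw [LinearMap.comp_apply, LinearEquiv.coe_coe] at h2
    have h3 := congrArg Subtype.val ((LinearEquiv.ofInjective f hf).apply_symm_apply
      ((LinearMap.toSpanSingleton R E e ∘ₗ I.subtype).codRestrict (LinearMap.range f)
        (fun x => hIe x x.2) ⟨x, hx⟩))
    rw [LinearEquiv.ofInjective_apply, h2] at h3
    rw [smul_sub, ← map_smul, sub_eq_zero]
    exact h3.symm
  exact he ⟨y, (sub_eq_zero.1 (hE _ hy)).symm⟩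

section Facets

variable {V : Type} (k : Type) [Field k]

/-- The prime ideal generated by the variables outside `F`. -/
noncomputable def faceIdeal (F : Finset V) : Ideal (MvPolynomial V k) :=
  Ideal.span (X '' (F : Set V)ᶜ)

variable {k}

lemma X_mem_faceIdeal {F : Finset V} {i : V} : 
    (X i : MvPolynomial V k) ∈ faceIdeal k F ↔ i ∉ F := by
  rw [faceIdeal, mem_ideal_span_X_image, support_X]
  simp [Finsupp.single_apply_eq_zero]

lemma isPrime_faceIdeal (F : Finset V) : (faceIdeal k F).IsPrime := by
  classical
  let φ : MvPolynomial V k →ₐ[k] MvPolynomial V k := aeval fun i => if i ∈ F then X i else 0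
  have hφ : (Ideal.Quotient.mkₐ k (faceIdeal k F)).comp φ =
      Ideal.Quotient.mkₐ k (faceIdeal k F) := by
    ext i
    by_cases hi : i ∈ F
    · simp [φ, hi]
    · simpa [φ, hi] using (Ideal.Quotient.eq_zero_iff_mem.2 (X_mem_faceIdeal.2 hi)).symm
  have hker : faceIdeal k F = Ideal.comap φ ⊥ := by
    apply le_antisymm
    · rw [faceIdeal, Ideal.span_le]
      rintro _ ⟨i, hi, rfl⟩
      have hi' : i ∉ F := hi
      simp [φ, hi']
    · intro p hp
      have hp' : φ p = 0 := hp
      have := AlgHom.congr_fun hφ p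
      rw [AlgHom.comp_apply, hp', map_zero] at this
      exact Ideal.Quotient.eq_zero_iff_mem.1 this.symm
  rw [hker]
  exact Ideal.comap_isPrime φ ⊥

lemma faceIdeal_anti {F G : Finset V} (h : F ⊆ G) : faceIdeal k G ≤ faceIdeal k F :=
  Ideal.span_mono (Set.image_mono (Set.compl_subset_compl.2 h))

lemma srIdeal_le_faceIdeal {K : Set (Finset V)} (hK : IsComplex K) {F : Finset V} (hF : F ∈ K) :
    srIdeal k K ≤ faceIdeal k F := by
  rw [srIdeal, Ideal.span_le]
  rintro _ ⟨G, hG, rfl⟩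
  have : ¬ G ⊆ F := fun h => hG (hK.2 F hF G h)
  obtain ⟨i, hi, hiF⟩ := Finset.not_subset.1 this
  exact Ideal.mem_of_dvd _ (Finset.dvd_prod_of_mem _ hi) (X_mem_faceIdeal.2 hiF)

variable [Fintype V]

/-- A prime containing the Stanley–Reisner ideal contains all variables outside some face `F`, and
no variable of `F`. -/
lemma exists_face_of_srIdeal_le {K : Set (Finset V)} {Q : Ideal (MvPolynomial V k)} [Q.IsPrime]
    (hQ : srIdeal k K ≤ Q) :
    ∃ F ∈ K, faceIdeal k F ≤ Q ∧ ∀ i ∈ F, X i ∉ Q := by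
  classical
  refine ⟨Finset.univ.filter fun i => X i ∉ Q, ?_, ?_, by simp⟩
  · by_contra h
    have := hQ (Ideal.subset_span ⟨_, h, rfl⟩)
    rw [Ideal.IsPrime.prod_mem_iff] at this
    obtain ⟨i, hi, hiQ⟩ := this
    exact (Finset.mem_filter.1 hi).2 hiQ
  · rw [faceIdeal, Ideal.span_le]
    rintro _ ⟨i, hi, rfl⟩
    simpa using hi

lemma exists_isFacet_ge {K : Set (Finset V)} {F : Finset V} (hF : F ∈ K) :
    ∃ G, IsFacet K G ∧ F ⊆ G := by
  obtain ⟨G, hFG, hG⟩ := (Set.toFinite K).exists_le_maximal hF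
  exact ⟨G, ⟨hG.prop, fun H hH hGH => (hG.eq_of_le hH hGH).symm⟩, hFG⟩

variable [DecidableEq V]

/-- The degree of the monomial with exponent `c` in the variables outside `F`. -/
def outerDegree (F : Finset V) (c : V →₀ ℕ) : ℕ :=
  ∑ i ∈ Fᶜ, c i

lemma outerDegree_add (F : Finset V) (b c : V →₀ ℕ) :
    outerDegree F (b + c) = outerDegree F b + outerDegree F c := by
  simp [outerDegree, Finset.sum_add_distrib]

lemma outerDegree_single (F : Finset V) (i : V) (m : ℕ) :
    outerDegree F (Finsupp.single i m) = if i ∈ F then 0 else m := by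
  simp [outerDegree, Finsupp.single_apply]

lemma outerDegree_mono (F : Finset V) : Monotone (outerDegree F) :=
  fun _ _ h => Finset.sum_le_sum fun i _ => h i

lemma mem_faceIdeal_pow {F : Finset V} {ℓ : ℕ} {p : MvPolynomial V k} :
    p ∈ faceIdeal k F ^ ℓ ↔ ∀ c, coeff c p ≠ 0 → ℓ ≤ outerDegree F c := by
  constructor
  · have hup : ∀ m, IsUpperSet {c | m ≤ outerDegree F c} := fun m a b hab ha =>
      le_trans ha (outerDegree_mono F hab)
    suffices h : faceIdeal k F ^ ℓ ≤ restrictSupportIdeal k _ (hup ℓ) by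
      intro hp c hc
      exact h hp (mem_support_iff.2 hc)
    induction ℓ with
    | zero => intro p _ c _; simp
    | succ m ih =>
      rw [pow_succ, Ideal.mul_le]
      intro p hp q hq c hc
      obtain ⟨a, ha, b, hb, rfl⟩ := Finset.mem_add.1 (support_mul p q hc)
      have h1 : m ≤ outerDegree F a := ih hp ha
      rw [faceIdeal, mem_ideal_span_X_image] at hq
      obtain ⟨i, hi, hbi⟩ := hq b hb
      have h2 : b i ≤ outerDegree F b :=
        Finset.single_le_sum (f := fun i => b i) (fun _ _ => Nat.zero_le _) (by simpa using hi)
      show m + 1 ≤ outerDegree F (a + b)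
      rw [outerDegree_add]
      lia
  · intro h
    rw [p.as_sum]
    refine Ideal.sum_mem _ fun c hc => ?_
    rw [monomial_eq, Finsupp.prod_fintype _ _ (by simp), ← Finset.prod_compl_mul_prod F]
    refine Ideal.mul_mem_left _ _ (Ideal.mul_mem_right _ _ ?_)
    refine Ideal.pow_le_pow_right (h c (mem_support_iff.1 hc)) ?_
    rw [outerDegree, ← Finset.prod_pow_eq_pow_sum]
    exact Ideal.prod_mem_prod fun i hi =>
      Ideal.pow_mem_pow (X_mem_faceIdeal.2 (by simpa using hi)) _

lemma mem_minimalPrimes_srIdeal {K : Set (Finset V)} (hK : IsComplex K)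
    {P : Ideal (MvPolynomial V k)} :
    P ∈ (srIdeal k K).minimalPrimes ↔ ∃ F, IsFacet K F ∧ P = faceIdeal k F := by
  constructor
  · intro hP
    have := hP.1.1
    obtain ⟨F, hF, hFP, -⟩ := exists_face_of_srIdeal_le hP.1.2
    obtain ⟨G, hG, hFG⟩ := exists_isFacet_ge hF
    have hle : faceIdeal k G ≤ P := (faceIdeal_anti hFG).trans hFP
    exact ⟨G, hG, le_antisymm
      (hP.2 ⟨isPrime_faceIdeal G, srIdeal_le_faceIdeal hK hG.1⟩ hle) hle⟩
  · rintro ⟨F, hF, rfl⟩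
    refine ⟨⟨isPrime_faceIdeal F, srIdeal_le_faceIdeal hK hF.1⟩, ?_⟩
    rintro Q ⟨hQ, hle⟩ hQF
    obtain ⟨G, hG, hGQ, hGX⟩ := exists_face_of_srIdeal_le hle
    have hFG : F ⊆ G := by
      intro i hi
      by_contra hiG
      exact X_mem_faceIdeal.1 (hQF (hGQ (X_mem_faceIdeal.2 hiG))) hi
    rwa [← hF.2 G hG hFG]

variable (k) in
/-- The intersection of the `ℓ`-th powers of the primes attached to the members of `A`. -/
noncomputable def facesPow (A : Set (Finset V)) (ℓ : ℕ) : Ideal (MvPolynomial V k) :=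
  ⨅ F ∈ A, faceIdeal k F ^ ℓ

lemma mem_facesPow {A : Set (Finset V)} {ℓ : ℕ} {p : MvPolynomial V k} :
    p ∈ facesPow k A ℓ ↔ ∀ F ∈ A, ∀ c, coeff c p ≠ 0 → ℓ ≤ outerDegree F c := by
  simp only [facesPow, Submodule.mem_iInf, mem_faceIdeal_pow]

lemma symbPow_srIdeal {K : Set (Finset V)} (hK : IsComplex K) (ℓ : ℕ) :
    symbPow (srIdeal k K) ℓ = facesPow k {F | IsFacet K F} ℓ := by
  ext p
  simp only [symbPow, facesPow, Submodule.mem_sInf, Submodule.mem_iInf, Set.mem_ofPred_eq,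
    mem_minimalPrimes_srIdeal hK]
  constructor
  · intro h F hF
    exact h _ ⟨_, ⟨F, hF, rfl⟩, rfl⟩
  · rintro h _ ⟨_, ⟨F, hF, rfl⟩, rfl⟩
    exact h F hF

/-- Variables have no common torsion modulo the powers of nonempty faces. -/
lemma mem_facesPow_of_forall_X_mul_mem {A : Set (Finset V)} (hA : ∀ F ∈ A, F.Nonempty) {ℓ : ℕ}
    {p : MvPolynomial V k} (h : ∀ i, X i * p ∈ facesPow k A ℓ) : p ∈ facesPow k A ℓ := by
  rw [mem_facesPow]
  intro F hF c hc
  obtain ⟨i, hi⟩ := hA F hF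
  have := mem_facesPow.1 (h i) F hF (Finsupp.single i 1 + c) (by rwa [coeff_X_mul])
  simpa [outerDegree_add, outerDegree_single, hi] using this

end Facets

/-- If some `z ∉ J₁ + J₂` satisfies `I z ⊆ J₁ + J₂`, and `I` has no torsion modulo `J₁` and `J₂`,
then `Ext¹(R/I, R/(J₁ ∩ J₂)) ≠ 0`. -/
lemma nontrivial_extM_one_inf {R : Type} [CommRing R] {I J₁ J₂ : Ideal R}
    (h₁ : ∀ p, (∀ x ∈ I, x * p ∈ J₁) → p ∈ J₁) (h₂ : ∀ p, (∀ x ∈ I, x * p ∈ J₂) → p ∈ J₂)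
    {z : R} (hz : z ∉ J₁ ⊔ J₂) (hIz : ∀ x ∈ I, x * z ∈ J₁ ⊔ J₂) :
    Nontrivial (extM (ModuleCat.of R (R ⧸ I)) (ModuleCat.of R (R ⧸ (J₁ ⊓ J₂))) 1) := by
  have hmk : ∀ (J : Ideal R) (p : R), Submodule.mkQ J p = 0 ↔ p ∈ J := fun J p =>
    Submodule.Quotient.mk_eq_zero J
  let f : (R ⧸ (J₁ ⊓ J₂)) →ₗ[R] (R ⧸ J₁) × (R ⧸ J₂) :=
    (Submodule.factor inf_le_left).prod (Submodule.factor inf_le_right)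
  have hf : ∀ p, f (Submodule.mkQ _ p) = (Submodule.mkQ _ p, Submodule.mkQ _ p) := fun p => rfl
  refine nontrivial_extM_one_of_injective I _ f ?_ ?_ (0, Submodule.mkQ _ z) ?_ ?_
  · rw [injective_iff_map_eq_zero]
    intro y hy
    obtain ⟨p, rfl⟩ := Submodule.mkQ_surjective _ y
    rw [hf, Prod.mk_eq_zero, hmk, hmk] at hy
    exact (hmk _ _).2 hy
  · rintro ⟨y₁, y₂⟩ h
    obtain ⟨p₁, rfl⟩ := Submodule.mkQ_surjective _ y₁
    obtain ⟨p₂, rfl⟩ := Submodule.mkQ_surjective _ y₂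
    simp only [Prod.smul_mk, ← map_smul, Prod.mk_eq_zero, hmk, smul_eq_mul] at h ⊢
    exact ⟨h₁ _ fun x hx => (h x hx).1, h₂ _ fun x hx => (h x hx).2⟩
  · rintro ⟨y, hy⟩
    obtain ⟨p, rfl⟩ := Submodule.mkQ_surjective _ y
    rw [hf, Prod.mk.injEq, hmk, ← sub_eq_zero, ← map_sub, hmk] at hy
    have := Ideal.sub_mem _ (Ideal.mem_sup_left hy.1 : p ∈ J₁ ⊔ J₂) (Ideal.mem_sup_right hy.2)
    rw [sub_sub_cancel] at this
    exact hz this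
  · intro x hx
    obtain ⟨p, hp, q, hq, hpq⟩ := Submodule.mem_sup.1 (hIz x hx)
    refine ⟨Submodule.mkQ _ p, ?_⟩
    rw [hf, Prod.smul_mk, smul_zero, ← map_smul, smul_eq_mul, ← hpq, map_add, (hmk _ q).2 hq,
      add_zero, (hmk _ p).2 hp]

/-- If `t` is regular modulo `J` and some `z ∉ J + (t)` satisfies `I z ⊆ J + (t)`, and `t ∈ I`,
then `Ext¹(R/I, R/J) ≠ 0`. -/
lemma nontrivial_extM_one_of_regular {R : Type} [CommRing R] {I J : Ideal R} {t : R} (ht : t ∈ I)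
    (hreg : ∀ p, t * p ∈ J → p ∈ J) {z : R} (hz : z ∉ J ⊔ Ideal.span {t})
    (hIz : ∀ x ∈ I, x * z ∈ J ⊔ Ideal.span {t}) :
    Nontrivial (extM (ModuleCat.of R (R ⧸ I)) (ModuleCat.of R (R ⧸ J)) 1) := by
  have hmk : ∀ p : R, Submodule.mkQ J p = 0 ↔ p ∈ J := fun p => Submodule.Quotient.mk_eq_zero J
  refine nontrivial_extM_one_of_injective I _ (t • LinearMap.id : (R ⧸ J) →ₗ[R] R ⧸ J) ?_ ?_
    (Submodule.mkQ _ z) ?_ ?_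
  · rw [injective_iff_map_eq_zero]
    intro y hy
    obtain ⟨p, rfl⟩ := Submodule.mkQ_surjective _ y
    rw [LinearMap.smul_apply, LinearMap.id_apply, ← map_smul, hmk] at hy
    exact (hmk _).2 (hreg _ hy)
  · intro y h
    obtain ⟨p, rfl⟩ := Submodule.mkQ_surjective _ y
    have := h t ht
    rw [← map_smul, hmk] at this
    exact (hmk _).2 (hreg _ this)
  · rintro ⟨y, hy⟩
    obtain ⟨p, rfl⟩ := Submodule.mkQ_surjective _ y
    rw [LinearMap.smul_apply, LinearMap.id_apply, ← map_smul, ← sub_eq_zero, ← map_sub, hmk] at hy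
    have := Ideal.sub_mem _ (Ideal.mem_sup_right (Ideal.mem_span_singleton'.2 ⟨p, mul_comm p t⟩))
      (Ideal.mem_sup_left hy : _ ∈ J ⊔ Ideal.span {t})
    rw [smul_eq_mul, sub_sub_cancel] at this
    exact hz this
  · intro x hx
    obtain ⟨p, hp, q, hq, hpq⟩ := Submodule.mem_sup.1 (hIz x hx)
    obtain ⟨r, rfl⟩ := Ideal.mem_span_singleton'.1 hq
    refine ⟨Submodule.mkQ _ r, ?_⟩
    rw [LinearMap.smul_apply, LinearMap.id_apply, ← map_smul, ← map_smul, smul_eq_mul, smul_eq_mul,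
      ← hpq, map_add, (hmk _).2 hp, zero_add, mul_comm]

section MaxIdeal

variable {V k : Type} [Field k]

lemma X_mem_maxIdeal (i : V) : (X i : MvPolynomial V k) ∈ maxIdeal k V :=
  Ideal.subset_span ⟨i, rfl⟩

lemma forall_mem_maxIdeal_mul_mem_iff {T : Ideal (MvPolynomial V k)} {z : MvPolynomial V k} :
    (∀ x ∈ maxIdeal k V, x * z ∈ T) ↔ ∀ i, X i * z ∈ T := by
  refine ⟨fun h i => h _ (X_mem_maxIdeal i), fun h x hx => ?_⟩
  induction hx using Submodule.span_induction with
  | mem x hx => obtain ⟨i, rfl⟩ := hx; exact h i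
  | zero => simp
  | add x y _ _ hx hy => rw [add_mul]; exact T.add_mem hx hy
  | smul a x _ hx => rw [smul_eq_mul, mul_assoc]; exact T.mul_mem_left _ hx

/-- If powers of all variables multiply `z ∉ T` into `T`, then the socle modulo `T` is nonzero. -/
lemma exists_notMem_forall_X_mul_mem [Fintype V] {T : Ideal (MvPolynomial V k)}
    {z : MvPolynomial V k} (hz : z ∉ T) (N : ℕ) (hN : ∀ i, X i ^ N * z ∈ T) :
    ∃ w, w ∉ T ∧ ∀ x ∈ maxIdeal k V, x * w ∈ T := by
  classical
  simp only [forall_mem_maxIdeal_mul_mem_iff]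
  suffices h : ∀ s : Finset V, ∃ w, w ∉ T ∧ (∀ i ∈ s, X i * w ∈ T) ∧ ∀ i, X i ^ N * w ∈ T by
    obtain ⟨w, hw, hw', -⟩ := h Finset.univ
    exact ⟨w, hw, fun i => hw' i (Finset.mem_univ i)⟩
  intro s
  induction s using Finset.induction_on with
  | empty => exact ⟨z, hz, by simp, hN⟩
  | insert j s _ ih =>
    obtain ⟨w, hw, hws, hwN⟩ := ih
    have hex : ∃ t, X j ^ t * w ∈ T := ⟨N, hwN j⟩
    obtain ⟨t, ht⟩ : ∃ t, Nat.find hex = t + 1 := by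
      refine Nat.exists_eq_succ_of_ne_zero fun h0 => hw ?_
      simpa [h0] using Nat.find_spec hex
    have hmul : ∀ p, p * w ∈ T → p * (X j ^ t * w) ∈ T := fun p hp => by
      rw [mul_left_comm]
      exact T.mul_mem_left _ hp
    refine ⟨X j ^ t * w, Nat.find_min hex (by lia), ?_, fun i => hmul _ (hwN i)⟩
    intro i hi
    obtain rfl | hi := Finset.mem_insert.1 hi
    · have := Nat.find_spec hex
      rwa [ht, pow_succ', mul_assoc] at this
    · exact hmul _ (hws i hi)

end MaxIdeal

section Separation

variable {V : Type} [Fintype V] [DecidableEq V]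

/-- The facets `F` of `K` with `x^a ∉ P_F^ℓ` generate a disconnected complex: they split into two
nonempty classes such that facets from different classes are disjoint. -/
def Separates (K : Set (Finset V)) (ℓ : ℕ) (a : V →₀ ℕ) : Prop :=
  ∃ A : Set (Finset V), (∃ F ∈ A, IsFacet K F ∧ outerDegree F a < ℓ) ∧
    (∃ G ∉ A, IsFacet K G ∧ outerDegree G a < ℓ) ∧
    ∀ H ∈ A, ∀ H' ∉ A, IsFacet K H → IsFacet K H' → outerDegree H a < ℓ → outerDegree H' a < ℓ →
      Disjoint H H'

/-- For a pure complex whose facets have `d` elements, the separating exponents for `ℓ` can be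
shifted to separating exponents for `ℓ + d`. -/
lemma Separates.shift {K : Set (Finset V)} {ℓ d : ℕ} {a : V →₀ ℕ}
    (hd : ∀ F, IsFacet K F → F.card = d) (h : Separates K ℓ a) :
    ∃ b, Separates K (ℓ + d) b := by
  obtain ⟨A, ⟨F, hFA, hF, hFa⟩, ⟨G, hGA, hG, hGa⟩, hA⟩ := h
  have hFG := hA F hFA G hGA hF hG hFa hGa
  let e : V →₀ ℕ := Finsupp.equivFunOnFinite.symm fun i => if i ∈ F ∪ G then 1 else 0
  have he : ∀ H, outerDegree H e = ((F ∪ G) \ H).card := by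
    intro H
    simp only [outerDegree, e, Finsupp.equivFunOnFinite_symm_apply_apply, Finset.sum_boole]
    simp only [Nat.cast_id]
    congr 1
    ext i
    simp [and_comm]
  have hle : ∀ H, IsFacet K H → d ≤ outerDegree H e := by
    intro H hH
    rw [he]
    have := Finset.le_card_sdiff H (F ∪ G)
    rw [Finset.card_union_of_disjoint hFG, hd F hF, hd G hG, hd H hH] at this
    lia
  have hlt : ∀ H, IsFacet K H → outerDegree H (a + e) < ℓ + d → outerDegree H a < ℓ := by
    intro H hH h
    have := hle H hH
    rw [outerDegree_add] at h
    lia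
  refine ⟨a + e, A, ⟨F, hFA, hF, ?_⟩, ⟨G, hGA, hG, ?_⟩, fun H hH H' hH' hHK hHK' h h' =>
    hA H hH H' hH' hHK hHK' (hlt H hHK h) (hlt H' hHK' h')⟩
  · rw [outerDegree_add, he, Finset.union_sdiff_cancel_left hFG, hd G hG]
    lia
  · rw [outerDegree_add, he, Finset.union_sdiff_cancel_right hFG, hd F hF]
    lia

variable {k : Type} [Field k]

/-- A separating exponent produces a nonzero class in `Ext¹(S/m, S/I^(ℓ))`. -/
lemma Separates.nontrivial_extM_one {K : Set (Finset V)} {ℓ : ℕ} {a : V →₀ ℕ}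
    (h : Separates K ℓ a) (hne : ∀ F, IsFacet K F → F.Nonempty) :
    Nontrivial (extM (quotMod k (maxIdeal k V)) (quotMod k (facesPow k {F | IsFacet K F} ℓ)) 1) := by
  obtain ⟨A, ⟨F, hFA, hF, hFa⟩, ⟨G, hGA, hG, hGa⟩, hA⟩ := h
  have hinf : facesPow k {F | IsFacet K F} ℓ =
      facesPow k {F | F ∈ A ∧ IsFacet K F} ℓ ⊓ facesPow k {F | F ∉ A ∧ IsFacet K F} ℓ := by
    ext p
    simp only [Submodule.mem_inf, mem_facesPow, Set.mem_ofPred_eq]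
    grind
  set J₁ := facesPow k {F | F ∈ A ∧ IsFacet K F} ℓ with hJ₁
  set J₂ := facesPow k {F | F ∉ A ∧ IsFacet K F} ℓ with hJ₂
  have hcoeff : ∀ p ∈ J₁ ⊔ J₂, coeff a p = 0 := by
    intro p hp
    obtain ⟨q, hq, r, hr, rfl⟩ := Submodule.mem_sup.1 hp
    have h₁ : coeff a q = 0 := by
      by_contra h0
      exact hFa.not_ge (mem_facesPow.1 hq F ⟨hFA, hF⟩ a h0)
    have h₂ : coeff a r = 0 := by
      by_contra h0
      exact hGa.not_ge (mem_facesPow.1 hr G ⟨hGA, hG⟩ a h0)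
    rw [coeff_add, h₁, h₂, add_zero]
  have hmem : ∀ (B : Set (Finset V)) (i : V),
      (∀ H ∈ B, outerDegree H a < ℓ → i ∉ H) → X i ^ ℓ * monomial a 1 ∈ facesPow k B ℓ := by
    intro B i hB
    rw [mem_facesPow]
    intro H hH c hc
    rw [X_pow_eq_monomial, monomial_mul, coeff_monomial] at hc
    obtain rfl : Finsupp.single i ℓ + a = c := by
      by_contra hne
      simp [hne] at hc
    rw [outerDegree_add, outerDegree_single]
    by_cases hHa : outerDegree H a < ℓ
    · simp [hB H hH hHa]
    · lia
  obtain ⟨w, hw, hwm⟩ := exists_notMem_forall_X_mul_mem (T := J₁ ⊔ J₂) (z := monomial a 1)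
    (fun h => by simpa using hcoeff _ h) ℓ (by
      intro i
      by_cases hi : ∀ H ∈ {F | F ∈ A ∧ IsFacet K F}, outerDegree H a < ℓ → i ∉ H
      · exact Ideal.mem_sup_left (hmem _ i hi)
      · push Not at hi
        obtain ⟨H, hH, hHa, hiH⟩ := hi
        refine Ideal.mem_sup_right (hmem _ i fun H' hH' hHa' => ?_)
        exact Finset.disjoint_left.1 (hA H hH.1 H' hH'.1 hH.2 hH'.2 hHa hHa') hiH)
  rw [hinf]
  refine nontrivial_extM_one_inf (fun p hp => ?_) (fun p hp => ?_) hw hwm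
  · exact mem_facesPow_of_forall_X_mul_mem (fun F hF => hne F hF.2)
      (forall_mem_maxIdeal_mul_mem_iff.1 hp)
  · exact mem_facesPow_of_forall_X_mul_mem (fun F hF => hne F hF.2)
      (forall_mem_maxIdeal_mul_mem_iff.1 hp)

/-- If no exponent separates the facets and all facets have at least two vertices, then a family
`g` satisfying `x_j g_i = x_i g_j` modulo `I^(ℓ)` comes from a single polynomial. -/
lemma exists_X_mul_sub_mem {K : Set (Finset V)} {ℓ : ℕ} (hsep : ∀ a, ¬ Separates K ℓ a)
    (hcard : ∀ F, IsFacet K F → 2 ≤ F.card) {g : V → MvPolynomial V k}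
    (hg : ∀ i j, X j * g i - X i * g j ∈ facesPow k {F | IsFacet K F} ℓ) :
    ∃ y, ∀ i, X i * y - g i ∈ facesPow k {F | IsFacet K F} ℓ := by
  have hrel : ∀ i j F c, IsFacet K F → outerDegree F c < ℓ →
      coeff c (X j * g i) = coeff c (X i * g j) := by
    intro i j F c hF hc
    rw [← sub_eq_zero, ← coeff_sub]
    by_contra h0
    exact hc.not_ge (mem_facesPow.1 (hg i j) F hF c h0)
  have heq : ∀ a i F, IsFacet K F → outerDegree F (Finsupp.single i 1 + a) < ℓ → ∀ j ∈ F,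
      coeff (Finsupp.single i 1 + a) (g i) = coeff (Finsupp.single j 1 + a) (g j) := by
    intro a i F hF ha j hj
    have := hrel i j F (Finsupp.single j 1 + (Finsupp.single i 1 + a)) hF (by
      rw [outerDegree_add, outerDegree_single]
      simpa [hj] using ha)
    rwa [coeff_X_mul, add_left_comm, coeff_X_mul] at this
  have hle : ∀ (F : Finset V) (i : V) (a : V →₀ ℕ),
      outerDegree F a ≤ outerDegree F (Finsupp.single i 1 + a) :=
    fun F i a => outerDegree_mono F le_add_self
  have hv : ∀ a, ∃ v : k, ∀ i F, IsFacet K F → outerDegree F (Finsupp.single i 1 + a) < ℓ →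
      coeff (Finsupp.single i 1 + a) (g i) = v := by
    intro a
    by_cases hex : ∃ F, IsFacet K F ∧ outerDegree F a < ℓ
    swap
    · exact ⟨0, fun i F hF h => (hex ⟨F, hF, (hle F i a).trans_lt h⟩).elim⟩
    obtain ⟨F, hF, hFa⟩ := hex
    have hin : ∀ H, IsFacet K H → outerDegree H a < ℓ → ∀ i ∈ H, ∀ j ∈ H,
        coeff (Finsupp.single i 1 + a) (g i) = coeff (Finsupp.single j 1 + a) (g j) := by
      intro H hH hHa i hi j hj
      exact heq a i H hH (by simpa [outerDegree_add, outerDegree_single, hi] using hHa) j hj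
    obtain ⟨j₀, hj₀⟩ : F.Nonempty := Finset.card_pos.1 (by have := hcard F hF; lia)
    refine ⟨coeff (Finsupp.single j₀ 1 + a) (g j₀), fun i G hG hGa => ?_⟩
    have hGa' := (hle G i a).trans_lt hGa
    obtain ⟨j, hj⟩ : G.Nonempty := Finset.card_pos.1 (by have := hcard G hG; lia)
    rw [heq a i G hG hGa j hj]
    by_contra hne
    refine hsep a ⟨{H | ∀ j ∈ H, coeff (Finsupp.single j 1 + a) (g j) =
      coeff (Finsupp.single j₀ 1 + a) (g j₀)}, ⟨F, fun j hj => hin F hF hFa j hj j₀ hj₀, hF, hFa⟩,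
      ⟨G, fun h => hne (h j hj), hG, hGa'⟩, fun H hH H' hH' hHK hHK' hHa hHa' => ?_⟩
    rw [Finset.disjoint_left]
    intro i hi hi'
    exact hH' fun j hj => (hin H' hHK' hHa' j hj i hi').trans (hH i hi)
  choose v hv using hv
  let T : Finset (V →₀ ℕ) := Finset.univ.biUnion fun i =>
    (g i).support.image fun c => c - Finsupp.single i 1
  have hy : ∀ a, coeff a (∑ b ∈ T, monomial b (v b)) = if a ∈ T then v a else 0 := by
    intro a
    simp [coeff_sum, coeff_monomial]
  refine ⟨∑ b ∈ T, monomial b (v b), fun i => mem_facesPow.2 fun F hF c hc => ?_⟩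
  by_contra! hlt
  refine hc ?_
  rw [coeff_sub, sub_eq_zero]
  by_cases hci : c i = 0
  · rw [coeff_X_mul', if_neg (by simpa using hci)]
    obtain ⟨j, hj, hji⟩ := Finset.exists_mem_ne (hcard F hF) i
    have := hrel i j F (Finsupp.single j 1 + c) hF (by
      rw [outerDegree_add, outerDegree_single]
      simpa [hj] using hlt)
    rw [coeff_X_mul, coeff_X_mul', if_neg (by simp [hci, hji])] at this
    exact this.symm
  · obtain ⟨a, rfl⟩ : ∃ a, c = Finsupp.single i 1 + a := le_iff_exists_add.1 (by
      rw [Finsupp.single_le_iff]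
      lia)
    rw [coeff_X_mul, hy, hv a i F hF hlt]
    split_ifs with haT
    · rfl
    · rw [← hv a i F hF hlt]
      by_contra h0
      refine haT (Finset.mem_biUnion.2 ⟨i, Finset.mem_univ i, Finset.mem_image.2
        ⟨_, mem_support_iff.2 (Ne.symm h0), ?_⟩⟩)
      simp

/-- A nonzero class in `Ext¹(S/m, S/I^(ℓ))` yields a separating exponent. -/
lemma exists_separates_of_nontrivial_extM_one {K : Set (Finset V)} {ℓ : ℕ}
    (hcard : ∀ F, IsFacet K F → 2 ≤ F.card)
    (h : Nontrivial (extM (quotMod k (maxIdeal k V))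
      (quotMod k (facesPow k {F | IsFacet K F} ℓ)) 1)) :
    ∃ a, Separates K ℓ a := by
  by_contra! hsep
  set J := facesPow k {F | IsFacet K F} ℓ
  obtain ⟨φ, hφ⟩ : ∃ φ : maxIdeal k V →ₗ[MvPolynomial V k] MvPolynomial V k ⧸ J,
      ∀ y : MvPolynomial V k ⧸ J, ∃ x : maxIdeal k V, φ x ≠ (x : MvPolynomial V k) • y :=
    (nontrivial_extM_one_iff (maxIdeal k V) (quotMod k J)).1 h
  have hmk : ∀ p : MvPolynomial V k, Submodule.mkQ J p = 0 ↔ p ∈ J := fun p =>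
    Submodule.Quotient.mk_eq_zero J
  choose g hg using fun i => Submodule.mkQ_surjective J (φ ⟨X i, X_mem_maxIdeal i⟩)
  obtain ⟨y, hy⟩ := exists_X_mul_sub_mem hsep hcard (g := g) (by
    intro i j
    rw [← hmk, map_sub, ← smul_eq_mul, ← smul_eq_mul, map_smul, map_smul, hg, hg, ← map_smul,
      ← map_smul, sub_eq_zero]
    congr 1
    ext1
    exact mul_comm _ _)
  obtain ⟨⟨x, hx⟩, hne⟩ := hφ (Submodule.mkQ J y)
  refine hne ?_
  clear hne
  induction hx using Submodule.span_induction with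
  | mem x hx =>
    obtain ⟨i, rfl⟩ := hx
    rw [← hg i, ← map_smul, eq_comm, ← sub_eq_zero, ← map_sub, hmk]
    exact hy i
  | zero => exact φ.map_zero.trans (zero_smul _ _).symm
  | add x y hxm hym hx hy =>
    refine (φ.map_add ⟨x, hxm⟩ ⟨y, hym⟩).trans ?_
    rw [hx, hy]
    exact (add_smul x y _).symm
  | smul a x hxm hx =>
    refine (φ.map_smul a ⟨x, hxm⟩).trans ?_
    rw [hx]
    exact (smul_assoc a x _).symm

/-- If all facets are nonempty then `depth S/I^(ℓ) ≥ 1`. -/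
lemma not_nontrivial_extM_zero {K : Set (Finset V)} {ℓ : ℕ}
    (hne : ∀ F, IsFacet K F → F.Nonempty) :
    ¬ Nontrivial (extM (quotMod k (maxIdeal k V))
      (quotMod k (facesPow k {F | IsFacet K F} ℓ)) 0) := by
  intro h
  obtain ⟨y, hy, hym⟩ := exists_ne_zero_of_nontrivial_extM_zero _ _ h
  obtain ⟨p, rfl⟩ := Submodule.mkQ_surjective _ y
  refine hy ((Submodule.Quotient.mk_eq_zero _).2
    (mem_facesPow_of_forall_X_mul_mem hne fun i => ?_))
  exact (Submodule.Quotient.mk_eq_zero _).1 (hym _ (X_mem_maxIdeal i))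

/-- The powers of a prime generated by all variables but one have depth one. -/
lemma nontrivial_extM_one_of_unique_facet {K : Set (Finset V)} {ℓ : ℕ} (hℓ : 1 ≤ ℓ) {i : V}
    (hK : ∀ F, IsFacet K F ↔ F = {i}) :
    Nontrivial (extM (quotMod k (maxIdeal k V)) (quotMod k (facesPow k {F | IsFacet K F} ℓ)) 1) := by
  set J := facesPow k {F | IsFacet K F} ℓ with hJ
  have hle : J ⊔ Ideal.span {X i} ≤ RingHom.ker (constantCoeff (R := k) (σ := V)) := by
    refine sup_le (fun p hp => ?_) ?_
    · by_contra h0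
      have := mem_facesPow.1 hp {i} ((hK _).2 rfl) 0 h0
      simp only [outerDegree, Finsupp.coe_zero, Pi.zero_apply, Finset.sum_const_zero] at this
      lia
    · rw [Ideal.span_le]
      rintro _ rfl
      simp
  obtain ⟨w, hw, hwm⟩ := exists_notMem_forall_X_mul_mem (T := J ⊔ Ideal.span {X i}) (z := 1)
    (fun h => by simpa using hle h) ℓ (by
      intro j
      rw [mul_one]
      by_cases hj : j = i
      · subst hj
        exact Ideal.mem_sup_right (Ideal.pow_mem_of_mem _ (Ideal.mem_span_singleton_self _) _ hℓ)
      · refine Ideal.mem_sup_left (mem_facesPow.2 fun F hF c hc => ?_)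
        obtain rfl := (hK F).1 hF
        rw [coeff_X_pow] at hc
        obtain rfl : Finsupp.single j ℓ = c := by
          by_contra hne
          simp [hne] at hc
        simp [outerDegree_single, hj])
  refine nontrivial_extM_one_of_regular (X_mem_maxIdeal i) (fun p hp => ?_) hw hwm
  refine mem_facesPow.2 fun F hF c hc => ?_
  obtain rfl := (hK F).1 hF
  have := mem_facesPow.1 hp {i} hF (Finsupp.single i 1 + c) (by rwa [coeff_X_mul])
  simpa [outerDegree_add, outerDegree_single] using this

end Separation


/-- for a pure simplicial complex `Δ` with `dim Δ = d - 1` and `ℓ ≥ 1`,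
if `depth(S/I_Δ^(ℓ)) = 1` then `depth(S/I_Δ^(ℓ+d)) = 1`. -/
theorem depth_symbPow_periodic_one
    (k : Type) [Field k] (n d ℓ : ℕ) (hℓ : 1 ≤ ℓ)
    (K : Set (Finset (Fin n))) (hK : IsComplex K) (hpure : Pure K)
    (hdim : HasDimCard K d)
    (h1 : mdepth k (quotMod k (symbPow (srIdeal k K) ℓ)) = 1) :
    mdepth k (quotMod k (symbPow (srIdeal k K) (ℓ + d))) = 1 := by
  have hF : ∀ F, IsFacet K F → F.card = d := by
    obtain ⟨⟨G, hG, hGd⟩, hle⟩ := hdim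
    intro F hF
    rw [← hGd]
    refine hpure F G hF ⟨hG, fun H hH hGH => (Finset.eq_of_subset_of_card_le hGH ?_).symm⟩
    rw [hGd]
    exact hle H hH
  rcases Nat.eq_zero_or_pos d with rfl | hd
  · exact h1
  have hne : ∀ F, IsFacet K F → F.Nonempty := fun F h => Finset.card_pos.1 (by rw [hF F h]; lia)
  rw [symbPow_srIdeal hK] at h1 ⊢
  suffices h : Nontrivial (extM (quotMod k (maxIdeal k (Fin n)))
      (quotMod k (facesPow k {F | IsFacet K F} (ℓ + d))) 1) by
    refine le_antisymm (Nat.sInf_le h) (Nat.one_le_iff_ne_zero.2 fun h0 => ?_)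
    have := Nat.sInf_mem (s := {i : ℕ | Nontrivial (extM (quotMod k (maxIdeal k (Fin n)))
      (quotMod k (facesPow k {F | IsFacet K F} (ℓ + d))) i)}) ⟨1, h⟩
    rw [mdepth] at h0
    rw [h0] at this
    exact not_nontrivial_extM_zero hne this
  rcases (show 1 ≤ d from hd).eq_or_lt with rfl | hd
  · obtain ⟨G, hG, -⟩ := exists_isFacet_ge hK.1.some_mem
    by_cases hex : ∃ H, IsFacet K H ∧ H ≠ G
    · obtain ⟨H, hH, hHG⟩ := hex
      refine Separates.nontrivial_extM_one (a := 0) ⟨{G}, ⟨G, rfl, hG, ?_⟩, ⟨H, hHG, hH, ?_⟩, ?_⟩ hne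
      · simp [outerDegree]
      · simp [outerDegree]
      · rintro _ rfl H' hH' - hHK' - -
        obtain ⟨x, rfl⟩ := Finset.card_eq_one.1 (hF _ hG)
        obtain ⟨y, rfl⟩ := Finset.card_eq_one.1 (hF _ hHK')
        rw [Finset.disjoint_singleton]
        rintro rfl
        exact hH' rfl
    · push Not at hex
      obtain ⟨x, rfl⟩ := Finset.card_eq_one.1 (hF _ hG)
      exact nontrivial_extM_one_of_unique_facet (by lia) fun H =>
        ⟨hex H, fun h => h ▸ hG⟩
  · have hext : Nontrivial (extM (quotMod k (maxIdeal k (Fin n)))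
        (quotMod k (facesPow k {F | IsFacet K F} ℓ)) 1) := by
      have := Nat.sInf_mem (Nat.nonempty_of_sInf_eq_succ h1)
      rw [mdepth] at h1
      rwa [h1] at this
    obtain ⟨a, ha⟩ := exists_separates_of_nontrivial_extM_one (fun F h => by rw [hF F h]; lia) hext
    obtain ⟨b, hb⟩ := ha.shift hF
    exact hb.nontrivial_extM_one hne

end SerrePaper
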